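/- Let Λ be a finite simple graph with at least 5 vertices, no isolated vertices, and no embedded 3-cycles (triangles), and such that the complement graph Λ^c has no embedded 4-cycles, i.e., there are no four distinct vertices a,b,c,d of Λ such that none of ab, bc, cd, da is an edge of Λ. Then Λ is isomorphic to one of: the 5-cycle, K_{2,3}, K⁻_{2,3}, K_{3,3}, or K⁻_{3,3}. -/

import Mathlib

open SimpleGraph

/-- A graph whose vertex set is split into two nonempty independent parts, with at most one
non-adjacent pair across the parts, is complete bipartite or complete bipartite minus an edge. -/
lemma nonempty_iso_completeBipartiteGraph_or_deleteEdges {V : Type*} (G : SimpleGraph V)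
    {m n : ℕ} [NeZero m] [NeZero n] (f : Fin m ⊕ Fin n ≃ V)
    (hl : ∀ i j, ¬ G.Adj (f (.inl i)) (f (.inl j)))
    (hr : ∀ i j, ¬ G.Adj (f (.inr i)) (f (.inr j)))
    (hu : ∀ i j i' j', ¬ G.Adj (f (.inl i)) (f (.inr j)) → ¬ G.Adj (f (.inl i')) (f (.inr j')) →
      i = i' ∧ j = j') :
    Nonempty (G ≃g completeBipartiteGraph (Fin m) (Fin n)) ∨
    Nonempty (G ≃g (completeBipartiteGraph (Fin m) (Fin n)).deleteEdges
      {s(Sum.inl 0, Sum.inr 0)}) := by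
  by_cases hall : ∀ i j, G.Adj (f (.inl i)) (f (.inr j))
  · refine .inl ⟨RelIso.symm ⟨f, ?_⟩⟩
    rintro (i | i) (j | j)
    · simp [hl]
    · simp [hall]
    · simp [(hall _ _).symm]
    · simp [hr]
  · push Not at hall
    obtain ⟨i₀, j₀, h₀⟩ := hall
    let e : Fin m ⊕ Fin n ≃ V :=
      (Equiv.sumCongr (Equiv.swap 0 i₀) (Equiv.swap 0 j₀)).trans f
    have key : ∀ i j, G.Adj (e (.inl i)) (e (.inr j)) ↔ ¬ (i = 0 ∧ j = 0) := by
      intro i j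
      constructor
      · rintro h ⟨rfl, rfl⟩
        exact h₀ (by simpa [e] using h)
      · intro h
        by_contra hn
        obtain ⟨hi, hj⟩ := hu _ _ _ _ hn h₀
        refine h ⟨(Equiv.swap (0 : Fin m) i₀).injective ?_,
          (Equiv.swap (0 : Fin n) j₀).injective ?_⟩
        · simpa using hi
        · simpa using hj
    refine .inr ⟨RelIso.symm ⟨e, ?_⟩⟩
    rintro (i | i) (j | j)
    · simp [e, hl]
    · simp [key]
    · rw [G.adj_comm, key]
      simp [and_comm]
    · simp [e, hr]

section

variable {V : Type*} {G : SimpleGraph V}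

/-- If the complement of `G` has no `4`-cycle, independent sets have at most three vertices. -/
lemma card_le_three_of_forall_not_adj
    (hcompl : ∀ a b c d : V, a ≠ b → a ≠ c → a ≠ d → b ≠ c → b ≠ d → c ≠ d →
      ¬ G.Adj a b → ¬ G.Adj b c → ¬ G.Adj c d → ¬ G.Adj d a → False)
    {S : Finset V} (hS : ∀ a ∈ S, ∀ b ∈ S, ¬ G.Adj a b) : S.card ≤ 3 := by
  classical
  by_contra! h
  obtain ⟨T, hTS, hT⟩ := Finset.exists_subset_card_eq h
  obtain ⟨a, b, c, d, hab, hac, had, hbc, hbd, hcd, rfl⟩ := Finset.card_eq_four.mp hT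
  simp only [Finset.insert_subset_iff, Finset.singleton_subset_iff] at hTS
  obtain ⟨ha, hb, hc, hd⟩ := hTS
  exact hcompl a b c d hab hac had hbc hbd hcd (hS _ ha _ hb) (hS _ hb _ hc) (hS _ hc _ hd)
    (hS _ hd _ ha)

/-- In a bipartite graph without isolated vertices whose complement has no `4`-cycle, at most one
pair across the two parts is non-adjacent. -/
lemma eq_and_eq_of_not_adj (hnoiso : ∀ v : V, ∃ w : V, G.Adj v w)
    (hcompl : ∀ a b c d : V, a ≠ b → a ≠ c → a ≠ d → b ≠ c → b ≠ d → c ≠ d →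
      ¬ G.Adj a b → ¬ G.Adj b c → ¬ G.Adj c d → ¬ G.Adj d a → False)
    {S : Set V} (hS : ∀ a ∈ S, ∀ b ∈ S, ¬ G.Adj a b) (hS' : ∀ a ∉ S, ∀ b ∉ S, ¬ G.Adj a b)
    {a a' b b' : V} (ha : a ∈ S) (ha' : a' ∈ S) (hb : b ∉ S) (hb' : b' ∉ S)
    (h : ¬ G.Adj a b) (h' : ¬ G.Adj a' b') : a = a' ∧ b = b' := by
  have ne : ∀ {u v}, u ∈ S → v ∉ S → u ≠ v := fun hu hv huv => hv (huv ▸ hu)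
  by_cases haa : a = a' <;> by_cases hbb : b = b'
  · exact ⟨haa, hbb⟩
  · subst haa
    obtain ⟨x, hx⟩ := hnoiso a
    have hxS : x ∉ S := fun hxS => hS _ ha _ hxS hx
    exact (hcompl a b x b' (ne ha hb) (ne ha hxS) (ne ha hb') (by grind) hbb (by grind) h
      (hS' _ hb _ hxS) (hS' _ hxS _ hb') (fun h => h' h.symm)).elim
  · subst hbb
    obtain ⟨x, hx⟩ := hnoiso b
    have hxS : x ∈ S := by_contra fun hxS => hS' _ hb _ hxS hx
    exact (hcompl b a x a' (ne ha hb).symm (ne hxS hb).symm (ne ha' hb).symm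
      (fun e => h (e ▸ hx.symm)) haa (fun e => h' (e ▸ hx.symm)) (fun h' => h h'.symm)
      (hS _ ha _ hxS) (hS _ hxS _ ha') h').elim
  · exact (hcompl a b b' a' (ne ha hb) (ne ha hb') haa hbb (ne ha' hb).symm (ne ha' hb').symm h
      (hS' _ hb _ hb') (fun h => h' h.symm) (hS _ ha' _ ha)).elim

/-- The bipartite case of the classification. -/
lemma nonempty_iso_of_isBipartition [Fintype V] (hcard : 5 ≤ Fintype.card V)
    (hnoiso : ∀ v : V, ∃ w : V, G.Adj v w)
    (hcompl : ∀ a b c d : V, a ≠ b → a ≠ c → a ≠ d → b ≠ c → b ≠ d → c ≠ d →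
      ¬ G.Adj a b → ¬ G.Adj b c → ¬ G.Adj c d → ¬ G.Adj d a → False)
    {S : Set V} (hS : ∀ a ∈ S, ∀ b ∈ S, ¬ G.Adj a b) (hS' : ∀ a ∉ S, ∀ b ∉ S, ¬ G.Adj a b) :
    Nonempty (G ≃g completeBipartiteGraph (Fin 2) (Fin 3)) ∨
    Nonempty (G ≃g (completeBipartiteGraph (Fin 2) (Fin 3)).deleteEdges
      {s(Sum.inl 0, Sum.inr 0)}) ∨
    Nonempty (G ≃g completeBipartiteGraph (Fin 3) (Fin 3)) ∨
    Nonempty (G ≃g (completeBipartiteGraph (Fin 3) (Fin 3)).deleteEdges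
      {s(Sum.inl 0, Sum.inr 0)}) := by
  classical
  have main : ∀ (T : Set V) (m n : ℕ) [NeZero m] [NeZero n],
      (∀ a ∈ T, ∀ b ∈ T, ¬ G.Adj a b) → (∀ a ∉ T, ∀ b ∉ T, ¬ G.Adj a b) →
      Fintype.card T = m → Fintype.card ↥Tᶜ = n →
      Nonempty (G ≃g completeBipartiteGraph (Fin m) (Fin n)) ∨
      Nonempty (G ≃g (completeBipartiteGraph (Fin m) (Fin n)).deleteEdges
        {s(Sum.inl 0, Sum.inr 0)}) := by
    intro T m n _ _ hT hT' hm hn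
    let e₁ := (Fintype.equivFinOfCardEq hm).symm
    let e₂ := (Fintype.equivFinOfCardEq hn).symm
    refine nonempty_iso_completeBipartiteGraph_or_deleteEdges G
      ((Equiv.sumCongr e₁ e₂).trans (Equiv.Set.sumCompl T)) ?_ ?_ ?_
    · intro i j
      exact hT _ (e₁ i).2 _ (e₁ j).2
    · intro i j
      exact hT' _ (e₂ i).2 _ (e₂ j).2
    · intro i j i' j' h h'
      obtain ⟨h₁, h₂⟩ := eq_and_eq_of_not_adj hnoiso hcompl hT hT' (e₁ i).2 (e₁ i').2
        (e₂ j).2 (e₂ j').2 h h'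
      exact ⟨e₁.injective (Subtype.ext h₁), e₂.injective (Subtype.ext h₂)⟩
  have c₁ : Fintype.card S ≤ 3 := by
    rw [← Set.toFinset_card]
    exact card_le_three_of_forall_not_adj hcompl (by simpa using hS)
  have c₂ : Fintype.card ↥Sᶜ ≤ 3 := by
    rw [← Set.toFinset_card]
    exact card_le_three_of_forall_not_adj hcompl (by simpa using hS')
  have c₃ : Fintype.card S + Fintype.card ↥Sᶜ = Fintype.card V := by
    rw [← Fintype.card_sum, Fintype.card_congr (Equiv.Set.sumCompl S)]
  obtain ⟨h₁, h₂⟩ | ⟨h₁, h₂⟩ | ⟨h₁, h₂⟩ :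
      (Fintype.card S = 2 ∧ Fintype.card ↥Sᶜ = 3) ∨ (Fintype.card S = 3 ∧ Fintype.card ↥Sᶜ = 2) ∨
      (Fintype.card S = 3 ∧ Fintype.card ↥Sᶜ = 3) := by omega
  · have := main S 2 3 hS hS' h₁ h₂
    tauto
  · have := main Sᶜ 2 3 hS' (by simpa using hS) (by convert h₂) (by simpa using h₁)
    tauto
  · have := main S 3 3 hS hS' h₁ h₂
    tauto

/-- A triangle-free graph containing a `5`-cycle, whose complement has no `4`-cycle, is that
`5`-cycle. -/
lemma nonempty_iso_cycleGraph_five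
    (hnotri : ∀ a b c : V, G.Adj a b → G.Adj b c → G.Adj a c → False)
    (hcompl : ∀ a b c d : V, a ≠ b → a ≠ c → a ≠ d → b ≠ c → b ≠ d → c ≠ d →
      ¬ G.Adj a b → ¬ G.Adj b c → ¬ G.Adj c d → ¬ G.Adj d a → False)
    {p q r s t : V} (hpq : G.Adj p q) (hqr : G.Adj q r) (hrs : G.Adj r s) (hst : G.Adj s t)
    (htp : G.Adj t p) : Nonempty (G ≃g cycleGraph 5) := by
  have hpr : ¬ G.Adj p r := fun h => hnotri _ _ _ hpq hqr h
  have hqs : ¬ G.Adj q s := fun h => hnotri _ _ _ hqr hrs h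
  have hrt : ¬ G.Adj r t := fun h => hnotri _ _ _ hrs hst h
  have hsp : ¬ G.Adj s p := fun h => hnotri _ _ _ hst htp h
  have htq : ¬ G.Adj t q := fun h => hnotri _ _ _ htp hpq h
  have npr : p ≠ r := by rintro rfl; exact hrt htp.symm
  have nqs : q ≠ s := by rintro rfl; exact hsp hpq.symm
  have nrt : r ≠ t := by rintro rfl; exact htq hqr.symm
  have nsp : s ≠ p := by rintro rfl; exact hpr hrs.symm
  have ntq : t ≠ q := by rintro rfl; exact hqs hst.symm
  have npq := hpq.ne
  have nqr := hqr.ne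
  have nrs := hrs.ne
  have nst := hst.ne
  have ntp := htp.ne
  have hinj : Function.Injective ![p, q, r, s, t] := by
    clear hcompl hnotri
    intro i j h
    fin_cases i <;> fin_cases j <;> simp at h ⊢ <;> grind
  have hsurj : Function.Surjective ![p, q, r, s, t] := by
    intro v
    by_contra! hv
    have alternate : ∀ {x y z}, G.Adj x y → x ≠ v → y ≠ v → z ≠ v → x ≠ z → z ≠ y →
        ¬ G.Adj x z → ¬ G.Adj z y → (G.Adj v x ↔ ¬ G.Adj v y) := by
      intro x y z hxy hx hy hz hxz hzy nxz nzy
      refine ⟨fun h₁ h₂ => hnotri _ _ _ h₁ hxy h₂, fun h₂ => by_contra fun h₁ => ?_⟩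
      exact hcompl v x z y hx.symm hz.symm hy.symm hxz hxy.ne hzy h₁ nxz nzy
        (fun h => h₂ h.symm)
    have v₀ : p ≠ v := hv 0
    have v₁ : q ≠ v := hv 1
    have v₂ : r ≠ v := hv 2
    have v₃ : s ≠ v := hv 3
    have v₄ : t ≠ v := hv 4
    have e₀ := alternate hpq v₀ v₁ v₃ nsp.symm nqs.symm (mt Adj.symm hsp) (mt Adj.symm hqs)
    have e₁ := alternate hqr v₁ v₂ v₄ ntq.symm nrt.symm (mt Adj.symm htq) (mt Adj.symm hrt)
    have e₂ := alternate hrs v₂ v₃ v₀ npr.symm nsp.symm (mt Adj.symm hpr) (mt Adj.symm hsp)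
    have e₃ := alternate hst v₃ v₄ v₁ nqs.symm ntq.symm (mt Adj.symm hqs) (mt Adj.symm htq)
    have e₄ := alternate htp v₄ v₀ v₂ nrt.symm npr.symm (mt Adj.symm hrt) (mt Adj.symm hpr)
    tauto
  refine ⟨RelIso.symm ⟨Equiv.ofBijective _ ⟨hinj, hsurj⟩, ?_⟩⟩
  intro i j
  change G.Adj (![p, q, r, s, t] i) (![p, q, r, s, t] j) ↔ _
  have adj_iff : (cycleGraph 5).Adj i j ↔ i - j = 1 ∨ j - i = 1 := cycleGraph_adj
  rw [adj_iff]
  clear hcompl hnotri adj_iff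
  fin_cases i <;> fin_cases j <;>
    simp [hpq, hqr, hrs, hst, htp, hpr, hqs, hrt, hsp, htq, hpq.symm, hqr.symm, hrs.symm,
      hst.symm, htp.symm, mt Adj.symm hpr, mt Adj.symm hqs, mt Adj.symm hrt, mt Adj.symm hsp,
      mt Adj.symm htq] <;> decide

end

/-- Let `Λ` be a finite simple graph with at least `5` vertices, no
isolated vertices, no triangles, and whose complement graph has no embedded `4`-cycles.
Then `Λ` is isomorphic to the `5`-cycle, `K_{2,3}`, `K⁻_{2,3}`, `K_{3,3}`, or `K⁻_{3,3}`. -/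
theorem graph_classification {V : Type*} [Fintype V] (G : SimpleGraph V)
    (hcard : 5 ≤ Fintype.card V)
    (hnoiso : ∀ v : V, ∃ w : V, G.Adj v w)
    (hnotri : ∀ a b c : V, G.Adj a b → G.Adj b c → G.Adj a c → False)
    (hcompl : ∀ a b c d : V, a ≠ b → a ≠ c → a ≠ d → b ≠ c → b ≠ d → c ≠ d →
      ¬ G.Adj a b → ¬ G.Adj b c → ¬ G.Adj c d → ¬ G.Adj d a → False) :
    Nonempty (G ≃g cycleGraph 5) ∨
    Nonempty (G ≃g completeBipartiteGraph (Fin 2) (Fin 3)) ∨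
    Nonempty (G ≃g (completeBipartiteGraph (Fin 2) (Fin 3)).deleteEdges
      {s(Sum.inl 0, Sum.inr 0)}) ∨
    Nonempty (G ≃g completeBipartiteGraph (Fin 3) (Fin 3)) ∨
    Nonempty (G ≃g (completeBipartiteGraph (Fin 3) (Fin 3)).deleteEdges
      {s(Sum.inl 0, Sum.inr 0)}) := by
  obtain ⟨u⟩ : Nonempty V := Fintype.card_pos_iff.mp (by omega)
  obtain ⟨v, huv⟩ := hnoiso u
  have unique : ∀ x y, ¬ G.Adj u x → ¬ G.Adj v x → ¬ G.Adj u y → ¬ G.Adj v y → x = y := by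
    intro x y hux hvx huy hvy
    by_contra hxy
    exact hcompl u x v y (fun e => hvx (e ▸ huv.symm)) huv.ne (fun e => hvy (e ▸ huv.symm))
      (fun e => hux (e ▸ huv)) hxy (fun e => huy (e ▸ huv)) hux (fun h => hvx h.symm) hvy
      (fun h => huy h.symm)
  by_cases hC : ∃ a b r, G.Adj u a ∧ G.Adj v b ∧ G.Adj r a ∧ G.Adj r b
  · obtain ⟨a, b, r, hua, hvb, hra, hrb⟩ := hC
    exact .inl (nonempty_iso_cycleGraph_five hnotri hcompl huv hvb hrb.symm hra hua.symm)
  · right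
    by_cases hR : ∃ r b, ¬ G.Adj u r ∧ ¬ G.Adj v r ∧ G.Adj v b ∧ G.Adj r b
    · obtain ⟨r, b, hur, hvr, hvb, hrb⟩ := hR
      refine nonempty_iso_of_isBipartition (S := {x | G.Adj v x}) hcard hnoiso hcompl
        (fun x hx y hy h => hnotri _ _ _ hx h hy) (fun x hx y hy h => ?_)
      simp only [Set.mem_ofPred_eq] at hx hy
      by_cases hux : G.Adj u x <;> by_cases huy : G.Adj u y
      · exact hnotri _ _ _ hux h huy
      · obtain rfl := unique _ _ huy hy hur hvr
        exact hC ⟨x, b, y, hux, hvb, h.symm, hrb⟩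
      · obtain rfl := unique _ _ hux hx hur hvr
        exact hC ⟨y, b, x, huy, hvb, h, hrb⟩
      · exact h.ne (unique _ _ hux hx huy hy)
    · refine nonempty_iso_of_isBipartition (S := {x | G.Adj u x}) hcard hnoiso hcompl
        (fun x hx y hy h => hnotri _ _ _ hx h hy) (fun x hx y hy h => ?_)
      simp only [Set.mem_ofPred_eq] at hx hy
      by_cases hvx : G.Adj v x <;> by_cases hvy : G.Adj v y
      · exact hnotri _ _ _ hvx h hvy
      · exact hR ⟨y, x, hy, hvy, hvx, h.symm⟩
      · exact hR ⟨x, y, hx, hvx, hvy, h⟩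
      · exact h.ne (unique _ _ hx hvx hy hvy)
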